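/- arXiv:2010.14322 — 3 statements merged into one kernel-verified Lean document; each statement's English description precedes it below -/
import Mathlib

section
/- Let (s,θ) ∈ S × [0,1]^n, z = Forward(s,θ), y_i = ∂ψ_i(s, z_{1:i}, θ_{i+1:n})/∂z_i, and r_i = θ_i y_i⁺ + (1−θ_i) y_i⁻. Then ‖∇_z 𝓛(s,z,y)‖_2 ≤ ‖∇_z μ − ∇_z η‖_2 · ‖r‖_2, where ∇_z μ − ∇_z η is the n × n matrix whose (i,j) entry is ∂μ_i(s,z_{1:i−1})/∂z_j − ∂η_i(s,z_{1:i−1})/∂z_j for j < i and 0 for j ≥ i, and its norm is the spectral norm. -/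
open Finset

noncomputable section

/-- Euclidean (ℓ2) norm of a finite vector. -/
def en {k : ℕ} (x : Fin k → ℝ) : ℝ := Real.sqrt (∑ i, x i ^ 2)

/-- Spectral norm (ℓ2→ℓ2 operator norm) of a matrix. -/
def specNorm {k l : ℕ} (M : Fin k → Fin l → ℝ) : ℝ :=
  sSup {v | ∃ x : Fin l → ℝ, (∑ j, x j ^ 2) ≤ 1 ∧ v = en (fun i => ∑ j, M i j * x j)}

/-- Partial derivative of `g` in the `j`-th coordinate at `x`. -/
def pd {k : ℕ} (g : (Fin k → ℝ) → ℝ) (x : Fin k → ℝ) (j : Fin k) : ℝ :=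
  deriv (fun t => g (Function.update x j t)) (x j)

/-- Euclidean diameter of a set of vectors. -/
def ediam {k : ℕ} (S : Set (Fin k → ℝ)) : ℝ :=
  sSup {v | ∃ a ∈ S, ∃ b ∈ S, v = en (fun j => a j - b j)}

variable {m n : ℕ}

/-- Forward completion: coordinates `< k` are read from `w`, later ones are computed via
`z_j = (1-θ_j) μ_j(s,z) + θ_j η_j(s,z)`. -/
def fwdFrom (μ η : Fin n → (Fin m → ℝ) → (Fin n → ℝ) → ℝ) (s : Fin m → ℝ)
    (θ : Fin n → ℝ) (k : ℕ) (w : Fin n → ℝ) : Fin n → ℝ :=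
  fun j => Nat.strongRecOn (motive := fun _ => ℝ) j.val (fun j ih =>
    if hj : j < n then
      if j < k then w ⟨j, hj⟩
      else
        (1 - θ ⟨j, hj⟩) * μ ⟨j, hj⟩ s (fun l => if h : (l : ℕ) < j then ih l.val h else 0)
          + θ ⟨j, hj⟩ * η ⟨j, hj⟩ s (fun l => if h : (l : ℕ) < j then ih l.val h else 0)
    else 0)

/-- `Forward(s,θ)`. -/
def Fwd (μ η : Fin n → (Fin m → ℝ) → (Fin n → ℝ) → ℝ) (s : Fin m → ℝ)
    (θ : Fin n → ℝ) : Fin n → ℝ :=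
  fwdFrom μ η s θ 0 0

/-- `ψ₀(s,θ) = f(s, Forward(s,θ))`. -/
def psi0 (f : (Fin m → ℝ) → (Fin n → ℝ) → ℝ)
    (μ η : Fin n → (Fin m → ℝ) → (Fin n → ℝ) → ℝ) (s : Fin m → ℝ) (θ : Fin n → ℝ) : ℝ :=
  f s (Fwd μ η s θ)

/-- `y_i = ∂ψ_i(s, z_{1:i}, θ_{i+1:n})/∂z_i` at `z = Forward(s,θ)`. -/
def psiD (f : (Fin m → ℝ) → (Fin n → ℝ) → ℝ)
    (μ η : Fin n → (Fin m → ℝ) → (Fin n → ℝ) → ℝ) (s : Fin m → ℝ) (θ : Fin n → ℝ) :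
    Fin n → ℝ :=
  fun i => deriv
    (fun t : ℝ => f s (fwdFrom μ η s θ ((i : ℕ) + 1) (Function.update (Fwd μ η s θ) i t)))
    (Fwd μ η s θ i)

/-- Gradient of `ψ₀` with respect to the `s` argument. -/
def gradSpsi0 (f : (Fin m → ℝ) → (Fin n → ℝ) → ℝ)
    (μ η : Fin n → (Fin m → ℝ) → (Fin n → ℝ) → ℝ) (s : Fin m → ℝ) (θ : Fin n → ℝ) :
    Fin m → ℝ :=
  fun j => pd (fun s' => psi0 f μ η s' θ) s j

/-- Gradient of `ψ₀` with respect to the `θ` argument. -/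
def gradTpsi0 (f : (Fin m → ℝ) → (Fin n → ℝ) → ℝ)
    (μ η : Fin n → (Fin m → ℝ) → (Fin n → ℝ) → ℝ) (s : Fin m → ℝ) (θ : Fin n → ℝ) :
    Fin n → ℝ :=
  fun i => pd (fun θ' => psi0 f μ η s θ') θ i

/-- `δ_L(s,θ)`: minus the optimal value of the projected-gradient step subproblem. -/
def deltaL (f : (Fin m → ℝ) → (Fin n → ℝ) → ℝ)
    (μ η : Fin n → (Fin m → ℝ) → (Fin n → ℝ) → ℝ) (S : Set (Fin m → ℝ)) (L : ℝ)
    (s : Fin m → ℝ) (θ : Fin n → ℝ) : ℝ :=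
  - sInf {v | ∃ ds : Fin m → ℝ, ∃ dθ : Fin n → ℝ, s + ds ∈ S ∧
      (∀ i, θ i + dθ i ∈ Set.Icc (0:ℝ) 1) ∧
      v = (∑ j, gradSpsi0 f μ η s θ j * ds j) + (∑ i, gradTpsi0 f μ η s θ i * dθ i)
          + L / 2 * ((∑ j, ds j ^ 2) + ∑ i, dθ i ^ 2)}

/-- The degeneracy index set `𝒦_γ(s,θ)`. -/
def Kset (f : (Fin m → ℝ) → (Fin n → ℝ) → ℝ)
    (μ η : Fin n → (Fin m → ℝ) → (Fin n → ℝ) → ℝ) (γ : ℝ) (s : Fin m → ℝ)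
    (θ : Fin n → ℝ) : Set (Fin n) :=
  {i | η i s (Fwd μ η s θ) - μ i s (Fwd μ η s θ) ≤ γ ∧
       0 < θ i * max (psiD f μ η s θ i) 0 + (1 - θ i) * max (-(psiD f μ η s θ i)) 0}

/-- The Lagrangian `𝓛(s,z,y)`. -/
def Lag (f : (Fin m → ℝ) → (Fin n → ℝ) → ℝ)
    (μ η : Fin n → (Fin m → ℝ) → (Fin n → ℝ) → ℝ) (s : Fin m → ℝ) (z y : Fin n → ℝ) : ℝ :=
  f s z + ∑ i, (max (y i) 0 * μ i s z - max (-(y i)) 0 * η i s z - y i * z i)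

/-- Gradient of the Lagrangian in the `s` argument. -/
def gradSLag (f : (Fin m → ℝ) → (Fin n → ℝ) → ℝ)
    (μ η : Fin n → (Fin m → ℝ) → (Fin n → ℝ) → ℝ) (s : Fin m → ℝ) (z y : Fin n → ℝ) :
    Fin m → ℝ :=
  fun j => pd (fun s' => Lag f μ η s' z y) s j

/-- Gradient of the Lagrangian in the `z` argument. -/
def gradZLag (f : (Fin m → ℝ) → (Fin n → ℝ) → ℝ)
    (μ η : Fin n → (Fin m → ℝ) → (Fin n → ℝ) → ℝ) (s : Fin m → ℝ) (z y : Fin n → ℝ) :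
    Fin n → ℝ :=
  fun j => pd (fun z' => Lag f μ η s z' y) z j

/-- The duality-gap estimate `Δ(s,θ)`. -/
def Delta (f : (Fin m → ℝ) → (Fin n → ℝ) → ℝ)
    (μ η : Fin n → (Fin m → ℝ) → (Fin n → ℝ) → ℝ) (S : Set (Fin m → ℝ))
    (Z : Set (Fin n → ℝ)) (s : Fin m → ℝ) (θ : Fin n → ℝ) : ℝ :=
  (∑ i, (psiD f μ η s θ i * Fwd μ η s θ i
      - max (psiD f μ η s θ i) 0 * μ i s (Fwd μ η s θ)
      + max (-(psiD f μ η s θ i)) 0 * η i s (Fwd μ η s θ)))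
  + sSup {v | ∃ sh ∈ S, ∃ zh ∈ Z,
      v = (∑ j, gradSLag f μ η s (Fwd μ η s θ) (psiD f μ η s θ) j * (sh j - s j))
        + ∑ i, gradZLag f μ η s (Fwd μ η s θ) (psiD f μ η s θ) i * (zh i - Fwd μ η s θ i)}

/-- Feasibility for the convex problem (P). -/
def Feas (μ η : Fin n → (Fin m → ℝ) → (Fin n → ℝ) → ℝ) (S : Set (Fin m → ℝ))
    (s : Fin m → ℝ) (z : Fin n → ℝ) : Prop :=
  s ∈ S ∧ ∀ i, μ i s z ≤ z i ∧ z i ≤ η i s z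

section Norms

variable {k l : ℕ}

theorem en_nonneg (x : Fin k → ℝ) : 0 ≤ en x := Real.sqrt_nonneg _

theorem en_sq (x : Fin k → ℝ) : en x ^ 2 = ∑ i, x i ^ 2 :=
  Real.sq_sqrt (Finset.sum_nonneg fun i _ => sq_nonneg (x i))

theorem en_smul (c : ℝ) (hc : 0 ≤ c) (x : Fin k → ℝ) : en (fun i => c * x i) = c * en x := by
  unfold en
  simp_rw [mul_pow]
  rw [← Finset.mul_sum, Real.sqrt_mul (sq_nonneg c), Real.sqrt_sq hc]

theorem sum_mul_le_en_mul_en (x y : Fin k → ℝ) : ∑ i, x i * y i ≤ en x * en y :=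
  Real.sum_mul_le_sqrt_mul_sqrt _ _ _

theorem bddAbove_specNorm (M : Fin k → Fin l → ℝ) :
    BddAbove {v | ∃ x : Fin l → ℝ, (∑ j, x j ^ 2) ≤ 1 ∧ v = en (fun i => ∑ j, M i j * x j)} := by
  refine ⟨Real.sqrt (∑ i, ∑ j, M i j ^ 2), ?_⟩
  rintro v ⟨x, hx, rfl⟩
  refine Real.sqrt_le_sqrt (Finset.sum_le_sum fun i _ => ?_)
  calc (∑ j, M i j * x j) ^ 2 ≤ (∑ j, M i j ^ 2) * ∑ j, x j ^ 2 :=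
        Finset.sum_mul_sq_le_sq_mul_sq _ _ _
    _ ≤ (∑ j, M i j ^ 2) * 1 := by gcongr
    _ = _ := mul_one _

theorem en_mulVec_le (M : Fin k → Fin l → ℝ) (x : Fin l → ℝ) :
    en (fun i => ∑ j, M i j * x j) ≤ specNorm M * en x := by
  rcases (en_nonneg x).eq_or_lt with h0 | hpos
  · have hx : ∀ j, x j = 0 := by
      have h := en_sq x
      rw [← h0, zero_pow two_ne_zero, eq_comm,
        Finset.sum_eq_zero_iff_of_nonneg fun i _ => sq_nonneg (x i)] at h
      exact fun j => pow_eq_zero_iff two_ne_zero |>.1 (h j (Finset.mem_univ j))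
    simp [hx, en]
  · have h : en (fun i => ∑ j, M i j * ((en x)⁻¹ * x j)) ≤ specNorm M := by
      refine le_csSup (bddAbove_specNorm M) ⟨_, ?_, rfl⟩
      simp_rw [mul_pow]
      rw [← Finset.mul_sum, ← en_sq, ← mul_pow, inv_mul_cancel₀ hpos.ne', one_pow]
    have h' : (fun i => ∑ j, M i j * ((en x)⁻¹ * x j))
        = fun i => (en x)⁻¹ * ∑ j, M i j * x j := by
      funext i
      rw [Finset.mul_sum]
      exact Finset.sum_congr rfl fun j _ => by ring
    rw [h', en_smul _ (inv_nonneg.2 hpos.le), inv_mul_le_iff₀ hpos] at h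
    linarith

theorem en_vecMul_le (M : Fin k → Fin l → ℝ) (r : Fin k → ℝ) :
    en (fun j => ∑ i, r i * M i j) ≤ specNorm M * en r := by
  set g : Fin l → ℝ := fun j => ∑ i, r i * M i j with hg
  have h1 : en g ^ 2 = ∑ i, r i * ∑ j, M i j * g j := by
    rw [en_sq]
    simp_rw [Finset.mul_sum]
    rw [Finset.sum_comm]
    refine Finset.sum_congr rfl fun j _ => ?_
    rw [sq]
    nth_rewrite 1 [hg]
    rw [Finset.sum_mul]
    exact Finset.sum_congr rfl fun i _ => by ring
  have h2 : en g ^ 2 ≤ en r * (specNorm M * en g) :=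
    h1.le.trans <| (sum_mul_le_en_mul_en _ _).trans <|
      mul_le_mul_of_nonneg_left (en_mulVec_le M g) (en_nonneg r)
  rcases (en_nonneg g).eq_or_lt with h0 | hpos
  · rw [← h0]
    refine mul_nonneg (Real.sSup_nonneg ?_) (en_nonneg r)
    rintro v ⟨x, -, rfl⟩
    exact en_nonneg _
  · nlinarith

end Norms

section PartialDerivatives

variable {n : ℕ}

theorem HasFDerivAt.hasDerivAt_update {g : (Fin n → ℝ) → ℝ} {g' : (Fin n → ℝ) →L[ℝ] ℝ}
    {x : Fin n → ℝ} (hg : HasFDerivAt g g' x) (j : Fin n) :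
    HasDerivAt (fun t => g (Function.update x j t)) (g' (Pi.single j 1)) (x j) := by
  have h := _root_.hasDerivAt_update x j (x j)
  exact HasFDerivAt.comp_hasDerivAt (x j) (by rwa [Function.update_eq_self]) h

theorem DifferentiableAt.hasDerivAt_pd {g : (Fin n → ℝ) → ℝ} {x : Fin n → ℝ}
    (hg : DifferentiableAt ℝ g x) (j : Fin n) :
    HasDerivAt (fun t => g (Function.update x j t)) (pd g x j) (x j) :=
  (hg.hasFDerivAt.hasDerivAt_update j).differentiableAt.hasDerivAt

theorem DifferentiableAt.hasDerivAt_comp_pi {g : (Fin n → ℝ) → ℝ} {W : ℝ → Fin n → ℝ}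
    {v : Fin n → ℝ} {t : ℝ} (hg : DifferentiableAt ℝ g (W t))
    (hW : ∀ l, HasDerivAt (fun t => W t l) (v l) t) :
    HasDerivAt (fun t => g (W t)) (∑ l, pd g (W t) l * v l) t := by
  have h := hg.hasFDerivAt.comp_hasDerivAt t (hasDerivAt_pi.2 hW)
  refine h.congr_deriv ?_
  conv_lhs => rw [← Finset.univ_sum_single v, map_sum]
  refine Finset.sum_congr rfl fun l _ => ?_
  rw [show pd g (W t) l = _ from (hg.hasFDerivAt.hasDerivAt_update l).deriv, mul_comm,
    ← smul_eq_mul, ← map_smul, ← Pi.single_smul, smul_eq_mul, mul_one]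

theorem pd_eq_zero_of_dep {g : (Fin n → ℝ) → ℝ} {i j : Fin n}
    (hg : ∀ z z' : Fin n → ℝ, (∀ k, k < i → z k = z' k) → g z = g z') (hij : i ≤ j)
    (x : Fin n → ℝ) : pd g x j = 0 := by
  have h : (fun t => g (Function.update x j t)) = fun _ => g x := by
    funext t
    exact hg _ _ fun k hk => Function.update_of_ne (hk.trans_le hij).ne _ _
  rw [pd, h, deriv_const]

end PartialDerivatives

section Forward

variable {m n : ℕ} {μ η : Fin n → (Fin m → ℝ) → (Fin n → ℝ) → ℝ}

theorem fwdFrom_eq_trunc (s : Fin m → ℝ) (θ : Fin n → ℝ) (k : ℕ) (w : Fin n → ℝ) (j : Fin n) :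
    fwdFrom μ η s θ k w j = if (j : ℕ) < k then w j else
      (1 - θ j) * μ j s (fun l => if l < j then fwdFrom μ η s θ k w l else 0)
        + θ j * η j s (fun l => if l < j then fwdFrom μ η s θ k w l else 0) := by
  conv_lhs => unfold fwdFrom
  rw [Nat.strongRecOn_eq, dif_pos j.isLt]
  rfl

theorem fwdFrom_of_lt (s : Fin m → ℝ) (θ : Fin n → ℝ) {k : ℕ} (w : Fin n → ℝ) {j : Fin n}
    (hj : (j : ℕ) < k) : fwdFrom μ η s θ k w j = w j := by
  rw [fwdFrom_eq_trunc, if_pos hj]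

theorem fwdFrom_of_le
    (hμ : ∀ (i : Fin n) (s : Fin m → ℝ) (z z' : Fin n → ℝ),
      (∀ j, j < i → z j = z' j) → μ i s z = μ i s z')
    (hη : ∀ (i : Fin n) (s : Fin m → ℝ) (z z' : Fin n → ℝ),
      (∀ j, j < i → z j = z' j) → η i s z = η i s z')
    (s : Fin m → ℝ) (θ : Fin n → ℝ) {k : ℕ} (w : Fin n → ℝ) {j : Fin n} (hj : k ≤ j) :
    fwdFrom μ η s θ k w j = (1 - θ j) * μ j s (fwdFrom μ η s θ k w)
      + θ j * η j s (fwdFrom μ η s θ k w) := by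
  rw [fwdFrom_eq_trunc, if_neg hj.not_gt]
  have h : ∀ l, l < j → (if l < j then fwdFrom μ η s θ k w l else 0) = fwdFrom μ η s θ k w l :=
    fun l hl => if_pos hl
  rw [hμ j s _ _ h, hη j s _ _ h]

theorem fwdFrom_Fwd (s : Fin m → ℝ) (θ : Fin n → ℝ) (k : ℕ) :
    fwdFrom μ η s θ k (Fwd μ η s θ) = Fwd μ η s θ := by
  funext j
  induction j using WellFoundedLT.induction with
  | ind j ih =>
    rw [fwdFrom_eq_trunc]
    split_ifs with hj
    · rfl
    · have h : (fun l => if l < j then fwdFrom μ η s θ k (Fwd μ η s θ) l else 0)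
          = fun l => if l < j then fwdFrom μ η s θ 0 0 l else 0 := by
        funext l
        split_ifs with hl
        · exact ih l hl
        · rfl
      rw [h]
      conv_rhs => rw [Fwd, fwdFrom_eq_trunc, if_neg (Nat.not_lt_zero _)]

theorem differentiable_fwdFrom_update {s : Fin m → ℝ}
    (hμ : ∀ i, Differentiable ℝ (μ i s)) (hη : ∀ i, Differentiable ℝ (η i s))
    (θ : Fin n → ℝ) (k : ℕ) (w : Fin n → ℝ) (j i : Fin n) :
    Differentiable ℝ fun t => fwdFrom μ η s θ k (Function.update w j t) i := by
  induction i using WellFoundedLT.induction with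
  | ind i ih =>
    by_cases hi : (i : ℕ) < k
    · simp_rw [fwdFrom_of_lt s θ _ hi]
      exact differentiable_pi.1 (fun t => (hasDerivAt_update w j t).differentiableAt) i
    · simp_rw [fwdFrom_eq_trunc s θ k _ i, if_neg hi]
      have h : Differentiable ℝ fun t => fun l =>
          if l < i then fwdFrom μ η s θ k (Function.update w j t) l else 0 := by
        refine differentiable_pi.2 fun l => ?_
        split_ifs with hl
        · exact ih l hl
        · exact differentiable_const _
      exact (((hμ i).comp h).const_mul _).add (((hη i).comp h).const_mul _)

/-- Reverse-mode recursion for `ψ`: each partial derivative is determined by the later ones. -/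
theorem psiD_eq {f : (Fin m → ℝ) → (Fin n → ℝ) → ℝ} {s : Fin m → ℝ} (hf : Differentiable ℝ (f s))
    (hμ : ∀ i, Differentiable ℝ (μ i s)) (hη : ∀ i, Differentiable ℝ (η i s))
    (hμdep : ∀ (i : Fin n) (s : Fin m → ℝ) (z z' : Fin n → ℝ),
      (∀ j, j < i → z j = z' j) → μ i s z = μ i s z')
    (hηdep : ∀ (i : Fin n) (s : Fin m → ℝ) (z z' : Fin n → ℝ),
      (∀ j, j < i → z j = z' j) → η i s z = η i s z')
    (θ : Fin n → ℝ) (j : Fin n) :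
    psiD f μ η s θ j = pd (f s) (Fwd μ η s θ) j
      + ∑ i, psiD f μ η s θ i * ((1 - θ i) * pd (μ i s) (Fwd μ η s θ) j
          + θ i * pd (η i s) (Fwd μ η s θ) j) := by
  set z := Fwd μ η s θ with hz
  set W : Fin n → ℝ → Fin n → ℝ :=
    fun j t => fwdFrom μ η s θ ((j : ℕ) + 1) (Function.update z j t) with hW
  set A : Matrix (Fin n) (Fin n) ℝ :=
    fun i j => (1 - θ i) * pd (μ i s) z j + θ i * pd (η i s) z j with hA
  set V : Matrix (Fin n) (Fin n) ℝ := fun i j => deriv (fun t => W j t i) (z j) with hV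
  have hWz : ∀ j, W j (z j) = z := fun j => by
    simp only [hW, Function.update_eq_self, hz, fwdFrom_Fwd]
  have hWV : ∀ j i, HasDerivAt (fun t => W j t i) (V i j) (z j) := fun j i =>
    (differentiable_fwdFrom_update hμ hη θ _ z j i (z j)).hasDerivAt
  have hchain : ∀ (g : (Fin n → ℝ) → ℝ), Differentiable ℝ g → ∀ j,
      HasDerivAt (fun t => g (W j t)) (∑ l, pd g z l * V l j) (z j) := fun g hg j => by
    have h := (hg (W j (z j))).hasDerivAt_comp_pi (hWV j)
    rwa [hWz] at h
  have hA0 : ∀ {i l}, i ≤ l → A i l = 0 := fun {i l} hil => by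
    simp only [hA, pd_eq_zero_of_dep (hμdep i s) hil, pd_eq_zero_of_dep (hηdep i s) hil,
      mul_zero, add_zero]
  have hVlow : ∀ {i j}, i ≤ j → V i j = (1 : Matrix (Fin n) (Fin n) ℝ) i j := fun {i j} hij => by
    have h : (fun t => W j t i) = fun t => Function.update z j t i := by
      funext t
      exact fwdFrom_of_lt s θ _ (Nat.lt_succ_of_le hij)
    have h' := hasDerivAt_pi.1 (hasDerivAt_update z j (z j)) i
    simp only [hV, h]
    rw [h'.deriv, Matrix.one_apply, Pi.single_apply]
  have hVeq : V = 1 + A * V := by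
    ext i j
    rw [Matrix.add_apply, Matrix.mul_apply]
    rcases le_or_gt i j with hij | hij
    · rw [hVlow hij, left_eq_add]
      refine Finset.sum_eq_zero fun l _ => ?_
      rcases le_or_gt i l with hil | hil
      · rw [hA0 hil, zero_mul]
      · rw [hVlow (hil.le.trans hij), Matrix.one_apply_ne (hil.trans_le hij).ne, mul_zero]
    · rw [Matrix.one_apply_ne hij.ne', zero_add]
      have h : (fun t => W j t i) = fun t => (1 - θ i) * μ i s (W j t) + θ i * η i s (W j t) := by
        funext t
        exact fwdFrom_of_le hμdep hηdep s θ _ (Nat.succ_le_of_lt hij)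
      have h' := ((hchain _ (hμ i) j).const_mul (1 - θ i)).add
        ((hchain _ (hη i) j).const_mul (θ i))
      have h'' := hWV j i
      rw [h] at h''
      rw [h''.unique h', Finset.mul_sum, Finset.mul_sum, ← Finset.sum_add_distrib]
      exact Finset.sum_congr rfl fun l _ => by simp only [hA]; ring
  have hinv : V * (1 - A) = 1 := by
    rw [mul_eq_one_comm, Matrix.sub_mul, Matrix.one_mul, sub_eq_iff_eq_add]
    exact hVeq
  have hψ : psiD f μ η s θ = Matrix.vecMul (pd (f s) z) V :=
    funext fun j => (hchain _ hf j).deriv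
  have h : Matrix.vecMul (psiD f μ η s θ) (1 - A) = pd (f s) z := by
    rw [hψ, Matrix.vecMul_vecMul, hinv, Matrix.vecMul_one]
  rw [Matrix.vecMul_sub, Matrix.vecMul_one, sub_eq_iff_eq_add] at h
  exact congrFun h j

theorem gradZLag_eq {f : (Fin m → ℝ) → (Fin n → ℝ) → ℝ} {s : Fin m → ℝ}
    (hf : Differentiable ℝ (f s))
    (hμ : ∀ i, Differentiable ℝ (μ i s)) (hη : ∀ i, Differentiable ℝ (η i s))
    (z y : Fin n → ℝ) (j : Fin n) :
    gradZLag f μ η s z y j = pd (f s) z j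
      + ∑ i, (max (y i) 0 * pd (μ i s) z j - max (-(y i)) 0 * pd (η i s) z j) - y j := by
  have h := ((hf z).hasDerivAt_pd j).add <| HasDerivAt.fun_sum (u := Finset.univ) fun i _ =>
    ((((hμ i z).hasDerivAt_pd j).const_mul (max (y i) 0)).sub
      (((hη i z).hasDerivAt_pd j).const_mul (max (-(y i)) 0))).sub
      ((hasDerivAt_pi.1 (hasDerivAt_update z j (z j)) i).const_mul (y i))
  refine h.deriv.trans ?_
  rw [Finset.sum_sub_distrib, add_sub_assoc]
  simp [Pi.single_apply]

end Forward

/-- Lemma 7, inequality (20b): bound on ‖∇_z 𝓛‖₂. -/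
theorem stmt8
    (m n : ℕ) (hm : 0 < m) (hn : 0 < n)
    (S : Set (Fin m → ℝ)) (hSne : S.Nonempty) (hSconv : Convex ℝ S)
    (hSbdd : Bornology.IsBounded S)
    (f : (Fin m → ℝ) → (Fin n → ℝ) → ℝ)
    (μ η : Fin n → (Fin m → ℝ) → (Fin n → ℝ) → ℝ)
    (hfC1 : ContDiff ℝ 1 (fun p : (Fin m → ℝ) × (Fin n → ℝ) => f p.1 p.2))
    (hμC1 : ∀ i, ContDiff ℝ 1 (fun p : (Fin m → ℝ) × (Fin n → ℝ) => μ i p.1 p.2))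
    (hηC1 : ∀ i, ContDiff ℝ 1 (fun p : (Fin m → ℝ) × (Fin n → ℝ) => η i p.1 p.2))
    (hfconv : ConvexOn ℝ (S ×ˢ (Set.univ : Set (Fin n → ℝ)))
      (fun p : (Fin m → ℝ) × (Fin n → ℝ) => f p.1 p.2))
    (hμconv : ∀ i, ConvexOn ℝ (S ×ˢ (Set.univ : Set (Fin n → ℝ)))
      (fun p : (Fin m → ℝ) × (Fin n → ℝ) => μ i p.1 p.2))
    (hηconc : ∀ i, ConcaveOn ℝ (S ×ˢ (Set.univ : Set (Fin n → ℝ)))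
      (fun p : (Fin m → ℝ) × (Fin n → ℝ) => η i p.1 p.2))
    (hμdep : ∀ (i : Fin n) (s : Fin m → ℝ) (z z' : Fin n → ℝ),
      (∀ j, j < i → z j = z' j) → μ i s z = μ i s z')
    (hηdep : ∀ (i : Fin n) (s : Fin m → ℝ) (z z' : Fin n → ℝ),
      (∀ j, j < i → z j = z' j) → η i s z = η i s z')
    (s : Fin m → ℝ) (θ : Fin n → ℝ) (hs : s ∈ S) (hθ : ∀ i, θ i ∈ Set.Icc (0:ℝ) 1)
    (z y r : Fin n → ℝ) (hz : z = Fwd μ η s θ) (hy : ∀ i, y i = psiD f μ η s θ i)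
    (hr : ∀ i, r i = θ i * max (y i) 0 + (1 - θ i) * max (-(y i)) 0) :
    en (gradZLag f μ η s z y)
      ≤ specNorm (fun i j : Fin n =>
          if (j : ℕ) < (i : ℕ) then
            pd (fun z' => μ i s z') z j - pd (fun z' => η i s z') z j
          else 0) * en r := by
  have hpair : Differentiable ℝ (fun w : Fin n → ℝ => (s, w)) :=
    (differentiable_const s).prodMk differentiable_id
  have hf : Differentiable ℝ (f s) := (hfC1.differentiable one_ne_zero).comp hpair
  have hμ : ∀ i, Differentiable ℝ (μ i s) := fun i =>
    ((hμC1 i).differentiable one_ne_zero).comp hpair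
  have hη : ∀ i, Differentiable ℝ (η i s) := fun i =>
    ((hηC1 i).differentiable one_ne_zero).comp hpair
  refine le_of_eq_of_le (congrArg en (funext fun j => ?_)) (en_vecMul_le _ r)
  have hyj := psiD_eq hf hμ hη hμdep hηdep θ j
  simp_rw [← hy, ← hz] at hyj
  rw [gradZLag_eq hf hμ hη, hyj, add_sub_add_left_eq_sub,
    ← Finset.sum_sub_distrib]
  refine Finset.sum_congr rfl fun i _ => ?_
  split_ifs with hij
  · have hy' : max (y i) 0 - max (-(y i)) 0 = y i := by
      rcases le_total (y i) 0 with h | h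
      · rw [max_eq_right h, max_eq_left (by linarith)]; ring
      · rw [max_eq_left h, max_eq_right (by linarith)]; ring
    rw [hr]
    linear_combination ((1 - θ i) * pd (μ i s) z j + θ i * pd (η i s) z j) * hy'
  · have hij' : i ≤ j := not_lt.1 hij
    rw [pd_eq_zero_of_dep (hμdep i s) hij', pd_eq_zero_of_dep (hηdep i s) hij']
    ring

end
end

section
/- Suppose B > 0 and for every i ∈ {1,…,n} and all (s, z_{1:i−1}), (ŝ, ẑ_{1:i−1}) ∈ S × ℝ^{i−1}: |μ_i(s,z_{1:i−1}) − μ_i(ŝ,ẑ_{1:i−1})| + |η_i(s,z_{1:i−1}) − η_i(ŝ,ẑ_{1:i−1})| ≤ B ( ‖s−ŝ‖_1 + ‖z_{1:i−1} − ẑ_{1:i−1}‖_1 ). Suppose additionally β > 0 and each function (s, z_{1:i−1}) ↦ η_i(s,z_{1:i−1}) − μ_i(s,z_{1:i−1}) is β-Lipschitz with respect to the ℓ₁-norm on S × ℝ^{i−1}. Let s, ŝ ∈ S, θ, θ̂ ∈ [0,1]^n, z = Forward(s,θ), ẑ = Forward(ŝ,θ̂). Then for every i, | (η_i(s,z_{1:i−1})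 − μ_i(s,z_{1:i−1})) − (η_i(ŝ,ẑ_{1:i−1}) − μ_i(ŝ,ẑ_{1:i−1})) | ≤ β ‖s − ŝ‖_1 + β B^{−1} (1 + B)^n Σ_{i=1}^n ( |θ_i − θ̂_i| · |η_i(s,z_{1:i−1}) − μ_i(s,z_{1:i−1})| + ‖s − ŝ‖_1 ). -/
open Finset

noncomputable section

variable {m n : ℕ}

/-- The recursion satisfied by the forward pass. -/
theorem Fwd_apply (μ η : Fin n → (Fin m → ℝ) → (Fin n → ℝ) → ℝ)
    (hμdep : ∀ (i : Fin n) (s : Fin m → ℝ) (z z' : Fin n → ℝ),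
      (∀ j, j < i → z j = z' j) → μ i s z = μ i s z')
    (hηdep : ∀ (i : Fin n) (s : Fin m → ℝ) (z z' : Fin n → ℝ),
      (∀ j, j < i → z j = z' j) → η i s z = η i s z')
    (s : Fin m → ℝ) (θ : Fin n → ℝ) (i : Fin n) :
    Fwd μ η s θ i = (1 - θ i) * μ i s (Fwd μ η s θ) + θ i * η i s (Fwd μ η s θ) := by
  have htrunc : ∀ j, j < i →
      Fwd μ η s θ j = if (j : ℕ) < i then Fwd μ η s θ j else 0 :=
    fun j hj => (if_pos (Fin.lt_def.mp hj)).symm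
  rw [hμdep i s _ _ htrunc, hηdep i s _ _ htrunc]
  conv_lhs => unfold Fwd fwdFrom
  rw [Nat.strongRecOn_eq]
  simp only [i.isLt, dite_true, Nat.not_lt_zero, if_false]
  rfl

/-- Discrete Grönwall inequality for partial sums over `Fin n`. -/
theorem add_sum_Iio_le_pow_mul {D a : Fin n → ℝ} {B d : ℝ} (hB : 0 ≤ B)
    (ha : ∀ k, 0 ≤ a k) (hD : ∀ k, D k ≤ a k + B * (d + ∑ j ∈ Finset.Iio k, D j))
    (i : Fin n) :
    d + ∑ j ∈ Finset.Iio i, D j ≤ (1 + B) ^ (i : ℕ) * (d + ∑ j ∈ Finset.Iio i, a j) := by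
  obtain ⟨i, hi⟩ := i
  induction i with
  | zero =>
    have h : Finset.Iio (⟨0, hi⟩ : Fin n) = ∅ := by
      ext j
      simp [Fin.lt_def]
    simp [h]
  | succ i ih =>
    have hi' : i < n := Nat.lt_of_succ_lt hi
    have h : Finset.Iio (⟨i + 1, hi⟩ : Fin n) = insert ⟨i, hi'⟩ (Finset.Iio ⟨i, hi'⟩) := by
      ext j
      simp only [Finset.mem_Iio, Finset.mem_insert, Fin.lt_def, Fin.ext_iff]
      omega
    have hnot : (⟨i, hi'⟩ : Fin n) ∉ Finset.Iio (⟨i, hi'⟩ : Fin n) := by simp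
    rw [h, Finset.sum_insert hnot, Finset.sum_insert hnot]
    have hpow : a ⟨i, hi'⟩ ≤ (1 + B) ^ (i + 1) * a ⟨i, hi'⟩ :=
      le_mul_of_one_le_left (ha _) (one_le_pow₀ (by linarith))
    have hstep := mul_le_mul_of_nonneg_left (ih hi') (by linarith : 0 ≤ 1 + B)
    have hDi := hD ⟨i, hi'⟩
    simp only [pow_succ] at hpow hstep ⊢
    linarith

/-- Error recursion for a coordinate of the form `(1 - t) * u + t * v`. -/
theorem abs_interp_sub_interp_le {t t' u v u' v' c : ℝ} (ht' : t' ∈ Set.Icc (0 : ℝ) 1)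
    (h : |u - u'| + |v - v'| ≤ c) :
    |((1 - t) * u + t * v) - ((1 - t') * u' + t' * v')| ≤ |t - t'| * |v - u| + c := by
  have hsplit : ((1 - t) * u + t * v) - ((1 - t') * u' + t' * v')
      = (t - t') * (v - u) + ((1 - t') * (u - u') + t' * (v - v')) := by ring
  have hu : |(1 - t') * (u - u')| ≤ |u - u'| := by
    rw [abs_mul, abs_of_nonneg (by linarith [ht'.2])]
    exact mul_le_of_le_one_left (abs_nonneg _) (by linarith [ht'.1])
  have hv : |t' * (v - v')| ≤ |v - v'| := by
    rw [abs_mul, abs_of_nonneg ht'.1]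
    exact mul_le_of_le_one_left (abs_nonneg _) ht'.2
  rw [hsplit, ← abs_mul]
  linarith [abs_add_le ((t - t') * (v - u)) ((1 - t') * (u - u') + t' * (v - v')),
    abs_add_le ((1 - t') * (u - u')) (t' * (v - v'))]

/-- Corollary 1 (ℓ₁-stability of the slack η − μ along the forward pass). -/
theorem stmt17
    (m n : ℕ) (hm : 0 < m) (hn : 0 < n)
    (S : Set (Fin m → ℝ)) (hSne : S.Nonempty) (hSconv : Convex ℝ S)
    (hSbdd : Bornology.IsBounded S)
    (μ η : Fin n → (Fin m → ℝ) → (Fin n → ℝ) → ℝ)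
    (hμC1 : ∀ i, ContDiff ℝ 1 (fun p : (Fin m → ℝ) × (Fin n → ℝ) => μ i p.1 p.2))
    (hηC1 : ∀ i, ContDiff ℝ 1 (fun p : (Fin m → ℝ) × (Fin n → ℝ) => η i p.1 p.2))
    (hμconv : ∀ i, ConvexOn ℝ (S ×ˢ (Set.univ : Set (Fin n → ℝ)))
      (fun p : (Fin m → ℝ) × (Fin n → ℝ) => μ i p.1 p.2))
    (hηconc : ∀ i, ConcaveOn ℝ (S ×ˢ (Set.univ : Set (Fin n → ℝ)))
      (fun p : (Fin m → ℝ) × (Fin n → ℝ) => η i p.1 p.2))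
    (hμdep : ∀ (i : Fin n) (s : Fin m → ℝ) (z z' : Fin n → ℝ),
      (∀ j, j < i → z j = z' j) → μ i s z = μ i s z')
    (hηdep : ∀ (i : Fin n) (s : Fin m → ℝ) (z z' : Fin n → ℝ),
      (∀ j, j < i → z j = z' j) → η i s z = η i s z')
    (B : ℝ) (hB : 0 < B)
    (hLip : ∀ (i : Fin n), ∀ s ∈ S, ∀ sh ∈ S, ∀ z zh : Fin n → ℝ,
      |μ i s z - μ i sh zh| + |η i s z - η i sh zh|
        ≤ B * ((∑ j, |s j - sh j|) + ∑ j ∈ Finset.Iio i, |z j - zh j|))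
    (β : ℝ) (hβ : 0 < β)
    (hLipβ : ∀ (i : Fin n), ∀ s ∈ S, ∀ sh ∈ S, ∀ z zh : Fin n → ℝ,
      |(η i s z - μ i s z) - (η i sh zh - μ i sh zh)|
        ≤ β * ((∑ j, |s j - sh j|) + ∑ j ∈ Finset.Iio i, |z j - zh j|))
    (s sh : Fin m → ℝ) (hs : s ∈ S) (hsh : sh ∈ S)
    (θ θh : Fin n → ℝ) (hθ : ∀ i, θ i ∈ Set.Icc (0:ℝ) 1) (hθh : ∀ i, θh i ∈ Set.Icc (0:ℝ) 1)
    (z zh : Fin n → ℝ) (hz : z = Fwd μ η s θ) (hzh : zh = Fwd μ η sh θh) :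
    ∀ i : Fin n,
      |(η i s z - μ i s z) - (η i sh zh - μ i sh zh)|
        ≤ β * (∑ j, |s j - sh j|)
          + β * B⁻¹ * (1 + B) ^ n *
            ∑ k, (|θ k - θh k| * |η k s z - μ k s z| + ∑ j, |s j - sh j|) := by
  intro i
  set d : ℝ := ∑ j, |s j - sh j|
  have hd : 0 ≤ d := Finset.sum_nonneg fun _ _ => abs_nonneg _
  set a : Fin n → ℝ := fun k => |θ k - θh k| * |η k s z - μ k s z|
  have ha : ∀ k, 0 ≤ a k := fun k => by positivity
  have hD : ∀ k, |z k - zh k| ≤ a k + B * (d + ∑ j ∈ Finset.Iio k, |z j - zh j|) := by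
    intro k
    have hzk : z k = (1 - θ k) * μ k s z + θ k * η k s z := by
      rw [hz]
      exact Fwd_apply μ η hμdep hηdep s θ k
    have hzhk : zh k = (1 - θh k) * μ k sh zh + θh k * η k sh zh := by
      rw [hzh]
      exact Fwd_apply μ η hμdep hηdep sh θh k
    rw [hzk, hzhk]
    exact abs_interp_sub_interp_le (hθh k) (hLip k s hs sh hsh z zh)
  have hgron := add_sum_Iio_le_pow_mul hB.le ha hD i
  have hpow : (1 + B) ^ (i : ℕ) ≤ B⁻¹ * (1 + B) ^ n := by
    rw [inv_mul_eq_div, le_div_iff₀ hB]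
    calc (1 + B) ^ (i : ℕ) * B ≤ (1 + B) ^ (i : ℕ) * (1 + B) := by gcongr; linarith
      _ = (1 + B) ^ ((i : ℕ) + 1) := (pow_succ _ _).symm
      _ ≤ (1 + B) ^ n := pow_le_pow_right₀ (by linarith) i.isLt
  have hsum : d + ∑ j ∈ Finset.Iio i, a j ≤ ∑ k, (a k + d) := by
    have hn1 : (1 : ℝ) ≤ n := by exact_mod_cast hn
    have hle : ∑ j ∈ Finset.Iio i, a j ≤ ∑ k, a k :=
      Finset.sum_le_sum_of_subset_of_nonneg (Finset.subset_univ _) fun k _ _ => ha k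
    rw [Finset.sum_add_distrib, Finset.sum_const, Finset.card_univ, Fintype.card_fin,
      nsmul_eq_mul]
    linarith [le_mul_of_one_le_left hd hn1]
  have hpos : 0 ≤ d + ∑ j ∈ Finset.Iio i, a j :=
    add_nonneg hd (Finset.sum_nonneg fun k _ => ha k)
  have hmain : ∑ j ∈ Finset.Iio i, |z j - zh j|
      ≤ B⁻¹ * (1 + B) ^ n * ∑ k, (a k + d) := by
    have := mul_le_mul hpow hsum hpos (by positivity)
    linarith
  calc |(η i s z - μ i s z) - (η i sh zh - μ i sh zh)|
      ≤ β * (d + ∑ j ∈ Finset.Iio i, |z j - zh j|) := hLipβ i s hs sh hsh z zh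
    _ ≤ β * (d + B⁻¹ * (1 + B) ^ n * ∑ k, (a k + d)) := by gcongr
    _ = β * d + β * B⁻¹ * (1 + B) ^ n * ∑ k, (a k + d) := by ring

end
end

section
/- Suppose β, B > 0 and that f and each μ_i, η_i are β-smooth with respect to the ℓ₁-norm (their gradients satisfy ‖∇h(x) − ∇h(x′)‖_∞ ≤ β ‖x − x′‖_1) and B-Lipschitz with respect to the ℓ₁-norm. Let s ∈ S, θ, θ̂ ∈ [0,1]^n, z = Forward(s,θ), ẑ = Forward(s,θ̂), and define g ∈ ℝ^n by the backward recursion g_i = ∂f(s,z)/∂z_i + Σ_{j=i+1}^n g_j ( θ̂_j ∂η_j(s,z_{1:j−1})/∂z_i + (1−θ̂_j) ∂μ_j(s,z_{1:j−1})/∂z_i ). Then Σ_{i=1}^n | g_i − ∂ψ_i(s, ẑ_{1:i}, θ̂_{i+1:n})/∂ẑ_i | ≤ 2 β B^{−2} (1 + B)^{3n} Σ_{i=1}^n |θ_i − θ̂_i| · |η_i(s,z_{1:i−1}) − μ_i(s,z_{1:i−1})|. -/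
open Finset

noncomputable section

variable {m n : ℕ}

lemma fwdFrom_eq (μ η : Fin n → (Fin m → ℝ) → (Fin n → ℝ) → ℝ) (s : Fin m → ℝ)
    (hμ : ∀ (i : Fin n) (z z' : Fin n → ℝ), (∀ j, j < i → z j = z' j) → μ i s z = μ i s z')
    (hη : ∀ (i : Fin n) (z z' : Fin n → ℝ), (∀ j, j < i → z j = z' j) → η i s z = η i s z')
    (θ : Fin n → ℝ) (k : ℕ) (w : Fin n → ℝ) (j : Fin n) :
    fwdFrom μ η s θ k w j = if (j : ℕ) < k then w j
      else (1 - θ j) * μ j s (fwdFrom μ η s θ k w) + θ j * η j s (fwdFrom μ η s θ k w) := by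
  conv_lhs => rw [fwdFrom, Nat.strongRecOn_eq]
  rw [dif_pos j.isLt]
  split_ifs with hjk
  · rfl
  · congr 2
    · refine hμ j _ _ fun l hl => ?_
      rw [dif_pos (Fin.lt_def.1 hl)]
      rfl
    · refine hη j _ _ fun l hl => ?_
      rw [dif_pos (Fin.lt_def.1 hl)]
      rfl

lemma pd_eq_fderiv {k : ℕ} {g : (Fin k → ℝ) → ℝ} {x : Fin k → ℝ} (hg : DifferentiableAt ℝ g x)
    (j : Fin k) : pd g x j = fderiv ℝ g x (Pi.single j 1) := by
  have h : HasFDerivAt g (fderiv ℝ g x) (Function.update x j (x j)) := by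
    rw [Function.update_eq_self]
    exact hg.hasFDerivAt
  exact (h.comp_hasDerivAt (x j) (hasDerivAt_update x j (x j))).deriv

lemma hasDerivAt_comp_pd {k : ℕ} {g : (Fin k → ℝ) → ℝ} {w : ℝ → Fin k → ℝ} {v : Fin k → ℝ}
    {t : ℝ} (hg : DifferentiableAt ℝ g (w t)) (hw : HasDerivAt w v t) :
    HasDerivAt (fun τ => g (w τ)) (∑ j, v j * pd g (w t) j) t := by
  have h : ∑ j, v j * pd g (w t) j = fderiv ℝ g (w t) v := by
    conv_rhs => rw [← Finset.univ_sum_single v, map_sum]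
    refine Finset.sum_congr rfl fun j _ => ?_
    rw [pd_eq_fderiv hg, ← smul_eq_mul, ← map_smul, ← Pi.single_smul, smul_eq_mul, mul_one]
  rw [h]
  exact hg.hasFDerivAt.comp_hasDerivAt t hw

lemma abs_pd_le {k : ℕ} {g : (Fin k → ℝ) → ℝ} {B : ℝ} (hB : 0 ≤ B)
    (hg : ∀ x y, |g x - g y| ≤ B * ∑ i, |x i - y i|) (x : Fin k → ℝ) (j : Fin k) :
    |pd g x j| ≤ B := by
  rw [← Real.norm_eq_abs]
  refine norm_deriv_le_of_lip' hB (Filter.Eventually.of_forall fun t => ?_)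
  rw [Real.norm_eq_abs, Real.norm_eq_abs]
  refine (hg _ _).trans_eq ?_
  congr 1
  rw [Finset.sum_eq_single j]
  · simp
  · intro i _ hi
    simp [hi]
  · simp

lemma pd_eq_zero {k : ℕ} {g : (Fin k → ℝ) → ℝ} {i j : Fin k} (hij : j ≤ i)
    (hg : ∀ z z' : Fin k → ℝ, (∀ l, l < j → z l = z' l) → g z = g z') (x : Fin k → ℝ) :
    pd g x i = 0 := by
  have h : (fun t => g (Function.update x i t)) = fun _ => g x := by
    funext t
    refine hg _ _ fun l hl => ?_
    rw [Function.update_of_ne (hl.trans_le hij).ne]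
  rw [pd, h, deriv_const]

/-- Backpropagation: if each curve `w i` perturbs coordinate `i` and recomputes the coordinates
after it, then the derivatives of `f ∘ w i` obey the adjoint recursion. -/
lemma deriv_comp_eq_adjoint {f : (Fin n → ℝ) → ℝ} {h : Fin n → (Fin n → ℝ) → ℝ}
    (hf : Differentiable ℝ f) (hh : ∀ j, Differentiable ℝ (h j))
    (hdep : ∀ (i : Fin n) (z z' : Fin n → ℝ), (∀ j, j < i → z j = z' j) → h i z = h i z')
    {z : Fin n → ℝ} {w : Fin n → ℝ → Fin n → ℝ} (hz : ∀ i, w i (z i) = z)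
    (hlt : ∀ i j t, j < i → w i t j = z j) (hself : ∀ i t, w i t i = t)
    (hgt : ∀ i j t, i < j → w i t j = h j (w i t)) (i : Fin n) :
    deriv (fun t => f (w i t)) (z i) = pd f z i
      + ∑ j ∈ Finset.Ioi i, deriv (fun t => f (w j t)) (z j) * pd (h j) z i := by
  have hdiff : ∀ i j, DifferentiableAt ℝ (fun t => w i t j) (z i) := by
    intro i j
    induction j using WellFoundedLT.induction with
    | ind j ih =>
      rcases lt_trichotomy j i with hj | hj | hj
      · simp only [hlt i j _ hj]
        fun_prop
      · subst hj
        simp only [hself]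
        fun_prop
      · have heq : (fun t => w i t j) = fun t => h j (fun l => if l < j then w i t l else 0) := by
          funext t
          rw [hgt i j t hj]
          exact hdep j _ _ fun l hl => by rw [if_pos hl]
        rw [heq]
        refine (hh j _).comp (z i) (differentiableAt_pi.2 fun l => ?_)
        by_cases hl : l < j
        · simpa only [hl, if_true] using ih l hl
        · simp only [hl, if_false]
          fun_prop
  let V : Matrix (Fin n) (Fin n) ℝ := fun l i => deriv (fun t => w i t l) (z i)
  let A : Matrix (Fin n) (Fin n) ℝ := fun j i => pd (h j) z i
  have hw : ∀ i, HasDerivAt (w i) (fun l => V l i) (z i) := fun i =>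
    hasDerivAt_pi.2 fun l => (hdiff i l).hasDerivAt
  have hcomp : ∀ {g : (Fin n → ℝ) → ℝ}, Differentiable ℝ g → ∀ i,
      HasDerivAt (fun t => g (w i t)) (∑ l, V l i * pd g z l) (z i) := by
    intro g hg i
    have := hasDerivAt_comp_pd (hg (w i (z i))) (hw i)
    rwa [hz] at this
  have hA : ∀ j i, j ≤ i → A j i = 0 := fun j i hji => pd_eq_zero hji (hdep j) z
  have hV : (1 - A) * V = 1 := by
    rw [sub_mul, one_mul, sub_eq_iff_eq_add]
    ext j i
    rw [Matrix.add_apply, Matrix.mul_apply]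
    have hconst : ∀ l, l < i → V l i = 0 := by
      intro l hl
      simp only [V, hlt i l _ hl, deriv_const]
    have hzero : j ≤ i → ∑ l, A j l * V l i = 0 := by
      intro hj
      refine Finset.sum_eq_zero fun l _ => ?_
      rcases lt_or_ge l i with hl | hl
      · rw [hconst l hl, mul_zero]
      · rw [hA j l (hj.trans hl), zero_mul]
    rcases lt_trichotomy j i with hj | hj | hj
    · rw [hzero hj.le, hconst j hj, Matrix.one_apply_ne hj.ne, add_zero]
    · subst hj
      rw [hzero le_rfl, Matrix.one_apply_eq, add_zero]
      simp only [V, hself, deriv_id'']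
    · rw [Matrix.one_apply_ne hj.ne', zero_add]
      have heq : (fun t => w i t j) = fun t => h j (w i t) := funext fun t => hgt i j t hj
      have := (hcomp (hh j) i).deriv
      rw [← heq] at this
      simp only [mul_comm (A j _)]
      exact this
  have hV' : V = 1 + V * A := by
    have := mul_eq_one_comm.1 hV
    rw [mul_sub, mul_one, sub_eq_iff_eq_add] at this
    exact this
  have hVi : ∀ l, V l i = (1 : Matrix (Fin n) (Fin n) ℝ) l i + ∑ j, V l j * A j i := by
    intro l
    conv_lhs => rw [hV', Matrix.add_apply, Matrix.mul_apply]
  have hIoi : ∑ j ∈ Finset.Ioi i, deriv (fun t => f (w j t)) (z j) * pd (h j) z i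
      = ∑ j, deriv (fun t => f (w j t)) (z j) * A j i := by
    refine Finset.sum_subset (Finset.subset_univ _) fun j _ hj => ?_
    exact mul_eq_zero_of_right _ (hA j i (not_lt.1 fun hij => hj (Finset.mem_Ioi.2 hij)))
  rw [hIoi, (hcomp hf i).deriv]
  simp only [(hcomp hf _).deriv, hVi, add_mul, Finset.sum_add_distrib, Finset.sum_mul]
  congr 1
  · simp [Matrix.one_apply]
  · rw [Finset.sum_comm]
    refine Finset.sum_congr rfl fun j _ => Finset.sum_congr rfl fun l _ => ?_
    ring

lemma sum_le_of_le_add_sum_Iio {B : ℝ} (hB : 0 ≤ B) : ∀ {n : ℕ} {e d : Fin n → ℝ},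
    (∀ i, 0 ≤ d i) → (∀ i, e i ≤ d i + B * ∑ j ∈ Finset.Iio i, e j) →
    (1 + B) * ∑ i, e i ≤ (1 + B) ^ n * ∑ i, d i
  | 0, _, _, _, _ => by simp
  | n + 1, e, d, hd, he => by
    have ih := sum_le_of_le_add_sum_Iio hB (e := fun i : Fin n => e i.castSucc)
      (d := fun i => d i.castSucc) (fun i => hd _) fun i => by
        simpa [Fin.sum_Iio_castSucc] using he i.castSucc
    have hlast := he (Fin.last n)
    rw [Fin.Iio_last_eq_map, Finset.sum_map] at hlast
    simp only [Fin.coe_castSuccEmb] at hlast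
    rw [Fin.sum_univ_castSucc, Fin.sum_univ_castSucc, pow_succ']
    have h1 : 1 ≤ (1 + B) ^ n := one_le_pow₀ (by linarith)
    have h2 := mul_le_mul_of_nonneg_right h1 (hd (Fin.last n))
    rw [mul_assoc]
    exact mul_le_mul_of_nonneg_left (by linarith) (by linarith)

lemma sum_le_of_le_add_sum_Ioi {B a : ℝ} (hB : 0 ≤ B) : ∀ {n : ℕ} {r : Fin n → ℝ},
    (∀ i, r i ≤ a + B * ∑ j ∈ Finset.Ioi i, r j) → B * ∑ i, r i ≤ a * ((1 + B) ^ n - 1)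
  | 0, _, _ => by simp
  | n + 1, r, hr => by
    have ih := sum_le_of_le_add_sum_Ioi hB (r := fun i : Fin n => r i.succ) fun i => by
      simpa [Fin.sum_Ioi_succ] using hr i.succ
    have h0 := hr 0
    rw [Fin.sum_Ioi_zero] at h0
    rw [Fin.sum_univ_succ, pow_succ']
    have h1 := mul_le_mul_of_nonneg_left h0 hB
    have h2 := mul_le_mul_of_nonneg_left ih (by linarith : 0 ≤ 1 + B)
    linarith

/-- Stability of a backward recursion under perturbation of its coefficients. -/
lemma sum_abs_sub_adjoint_le {B ε : ℝ} (hB : 0 < B) {c c' g y : Fin n → ℝ}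
    {A A' : Fin n → Fin n → ℝ} (hε : 0 ≤ ε)
    (hg : ∀ i, g i = c i + ∑ j ∈ Finset.Ioi i, g j * A j i)
    (hy : ∀ i, y i = c' i + ∑ j ∈ Finset.Ioi i, y j * A' j i)
    (hc' : ∀ i, |c' i| ≤ B) (hA : ∀ j i, |A j i| ≤ B) (hA' : ∀ j i, |A' j i| ≤ B)
    (hcc : ∀ i, |c i - c' i| ≤ ε) (hAA : ∀ j i, |A j i - A' j i| ≤ ε) :
    B * ∑ i, |g i - y i| ≤ ε * (1 + B) ^ (2 * n) := by
  have hY : ∑ i, |y i| ≤ (1 + B) ^ n - 1 := by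
    refine le_of_mul_le_mul_left (sum_le_of_le_add_sum_Ioi hB.le fun i => ?_) hB
    rw [hy i, Finset.mul_sum]
    refine (abs_add_le _ _).trans (add_le_add (hc' i) ?_)
    refine (Finset.abs_sum_le_sum_abs _ _).trans (Finset.sum_le_sum fun j _ => ?_)
    rw [abs_mul, mul_comm B]
    exact mul_le_mul_of_nonneg_left (hA' j i) (abs_nonneg _)
  have hR := sum_le_of_le_add_sum_Ioi (r := fun i => |g i - y i|) (a := ε * (1 + B) ^ n) hB.le
    fun i => by
      have hsplit : g i - y i = (c i - c' i) + ∑ j ∈ Finset.Ioi i, y j * (A j i - A' j i)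
          + ∑ j ∈ Finset.Ioi i, (g j - y j) * A j i := by
        rw [hg i, hy i, add_assoc, ← Finset.sum_add_distrib, add_sub_add_comm,
          ← Finset.sum_sub_distrib]
        congr 1
        refine Finset.sum_congr rfl fun j _ => ?_
        ring
      have h1 : |∑ j ∈ Finset.Ioi i, y j * (A j i - A' j i)| ≤ ε * ∑ j, |y j| := by
        rw [Finset.mul_sum]
        refine (Finset.abs_sum_le_sum_abs _ _).trans (le_trans (Finset.sum_le_sum fun j _ => ?_)
          (Finset.sum_le_sum_of_subset_of_nonneg (Finset.subset_univ _)
            fun j _ _ => mul_nonneg hε (abs_nonneg _)))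
        rw [abs_mul, mul_comm ε]
        exact mul_le_mul_of_nonneg_left (hAA j i) (abs_nonneg _)
      have h2 : |∑ j ∈ Finset.Ioi i, (g j - y j) * A j i|
          ≤ B * ∑ j ∈ Finset.Ioi i, |g j - y j| := by
        rw [Finset.mul_sum]
        refine (Finset.abs_sum_le_sum_abs _ _).trans (Finset.sum_le_sum fun j _ => ?_)
        rw [abs_mul, mul_comm B]
        exact mul_le_mul_of_nonneg_left (hA j i) (abs_nonneg _)
      have h3 := mul_le_mul_of_nonneg_left hY hε
      have h4 := hcc i
      have h5 := abs_add_three (c i - c' i) (∑ j ∈ Finset.Ioi i, y j * (A j i - A' j i))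
        (∑ j ∈ Finset.Ioi i, (g j - y j) * A j i)
      rw [← hsplit] at h5
      linarith
  have h6 : 0 ≤ ε * (1 + B) ^ n := by positivity
  calc B * ∑ i, |g i - y i| ≤ ε * (1 + B) ^ n * ((1 + B) ^ n - 1) := hR
    _ ≤ ε * (1 + B) ^ n * (1 + B) ^ n := mul_le_mul_of_nonneg_left (by linarith) h6
    _ = ε * (1 + B) ^ (2 * n) := by ring

lemma abs_convexComb_le {t a b c : ℝ} (ht : t ∈ Set.Icc (0 : ℝ) 1) (ha : |a| ≤ c) (hb : |b| ≤ c) :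
    |t * a + (1 - t) * b| ≤ c := by
  refine abs_le.2 ((convex_Icc (-c) c) (abs_le.1 ha) (abs_le.1 hb) ht.1 (sub_nonneg.2 ht.2) ?_)
  ring

/-- Lemma 12: accuracy of the backpropagated gradient estimate g. -/
theorem stmt18
    (m n : ℕ) (hm : 0 < m) (hn : 0 < n)
    (S : Set (Fin m → ℝ)) (hSne : S.Nonempty) (hSconv : Convex ℝ S)
    (hSbdd : Bornology.IsBounded S)
    (f : (Fin m → ℝ) → (Fin n → ℝ) → ℝ)
    (μ η : Fin n → (Fin m → ℝ) → (Fin n → ℝ) → ℝ)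
    (hfC1 : ContDiff ℝ 1 (fun p : (Fin m → ℝ) × (Fin n → ℝ) => f p.1 p.2))
    (hμC1 : ∀ i, ContDiff ℝ 1 (fun p : (Fin m → ℝ) × (Fin n → ℝ) => μ i p.1 p.2))
    (hηC1 : ∀ i, ContDiff ℝ 1 (fun p : (Fin m → ℝ) × (Fin n → ℝ) => η i p.1 p.2))
    (hfconv : ConvexOn ℝ (S ×ˢ (Set.univ : Set (Fin n → ℝ)))
      (fun p : (Fin m → ℝ) × (Fin n → ℝ) => f p.1 p.2))
    (hμconv : ∀ i, ConvexOn ℝ (S ×ˢ (Set.univ : Set (Fin n → ℝ)))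
      (fun p : (Fin m → ℝ) × (Fin n → ℝ) => μ i p.1 p.2))
    (hηconc : ∀ i, ConcaveOn ℝ (S ×ˢ (Set.univ : Set (Fin n → ℝ)))
      (fun p : (Fin m → ℝ) × (Fin n → ℝ) => η i p.1 p.2))
    (hμdep : ∀ (i : Fin n) (s : Fin m → ℝ) (z z' : Fin n → ℝ),
      (∀ j, j < i → z j = z' j) → μ i s z = μ i s z')
    (hηdep : ∀ (i : Fin n) (s : Fin m → ℝ) (z z' : Fin n → ℝ),
      (∀ j, j < i → z j = z' j) → η i s z = η i s z')
    (β B : ℝ) (hβ : 0 < β) (hB : 0 < B)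
    (hfsmooth : ∀ (s s' : Fin m → ℝ) (z z' : Fin n → ℝ),
      (∀ j : Fin m, |pd (fun sv => f sv z) s j - pd (fun sv => f sv z') s' j|
          ≤ β * ((∑ jj, |s jj - s' jj|) + ∑ ii, |z ii - z' ii|)) ∧
      (∀ i : Fin n, |pd (fun zv => f s zv) z i - pd (fun zv => f s' zv) z' i|
          ≤ β * ((∑ jj, |s jj - s' jj|) + ∑ ii, |z ii - z' ii|)))
    (hμsmooth : ∀ (k : Fin n) (s s' : Fin m → ℝ) (z z' : Fin n → ℝ),
      (∀ j : Fin m, |pd (fun sv => μ k sv z) s j - pd (fun sv => μ k sv z') s' j|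
          ≤ β * ((∑ jj, |s jj - s' jj|) + ∑ ii, |z ii - z' ii|)) ∧
      (∀ i : Fin n, |pd (fun zv => μ k s zv) z i - pd (fun zv => μ k s' zv) z' i|
          ≤ β * ((∑ jj, |s jj - s' jj|) + ∑ ii, |z ii - z' ii|)))
    (hηsmooth : ∀ (k : Fin n) (s s' : Fin m → ℝ) (z z' : Fin n → ℝ),
      (∀ j : Fin m, |pd (fun sv => η k sv z) s j - pd (fun sv => η k sv z') s' j|
          ≤ β * ((∑ jj, |s jj - s' jj|) + ∑ ii, |z ii - z' ii|)) ∧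
      (∀ i : Fin n, |pd (fun zv => η k s zv) z i - pd (fun zv => η k s' zv) z' i|
          ≤ β * ((∑ jj, |s jj - s' jj|) + ∑ ii, |z ii - z' ii|)))
    (hfLip : ∀ (s s' : Fin m → ℝ) (z z' : Fin n → ℝ),
      |f s z - f s' z'| ≤ B * ((∑ jj, |s jj - s' jj|) + ∑ ii, |z ii - z' ii|))
    (hμLip : ∀ (k : Fin n) (s s' : Fin m → ℝ) (z z' : Fin n → ℝ),
      |μ k s z - μ k s' z'| ≤ B * ((∑ jj, |s jj - s' jj|) + ∑ ii, |z ii - z' ii|))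
    (hηLip : ∀ (k : Fin n) (s s' : Fin m → ℝ) (z z' : Fin n → ℝ),
      |η k s z - η k s' z'| ≤ B * ((∑ jj, |s jj - s' jj|) + ∑ ii, |z ii - z' ii|))
    (s : Fin m → ℝ) (hs : s ∈ S)
    (θ θh : Fin n → ℝ) (hθ : ∀ i, θ i ∈ Set.Icc (0:ℝ) 1) (hθh : ∀ i, θh i ∈ Set.Icc (0:ℝ) 1)
    (z zh : Fin n → ℝ) (hz : z = Fwd μ η s θ) (hzh : zh = Fwd μ η s θh)
    (g : Fin n → ℝ)
    (hg : ∀ i : Fin n, g i = pd (fun zv => f s zv) z i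
        + ∑ j ∈ Finset.Ioi i, g j *
            (θh j * pd (fun zv => η j s zv) z i + (1 - θh j) * pd (fun zv => μ j s zv) z i)) :
    (∑ i, |g i - psiD f μ η s θh i|)
      ≤ 2 * β / B ^ 2 * (1 + B) ^ (3 * n) *
        ∑ i, |θ i - θh i| * |η i s z - μ i s z| := by
  have hD : ∀ {h : (Fin m → ℝ) → (Fin n → ℝ) → ℝ},
      ContDiff ℝ 1 (fun p : (Fin m → ℝ) × (Fin n → ℝ) => h p.1 p.2) → Differentiable ℝ (h s) :=
    fun {h} hh => (hh.differentiable one_ne_zero).comp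
      ((differentiable_const s).prodMk differentiable_id)
  have hμL : ∀ k (x y : Fin n → ℝ), |μ k s x - μ k s y| ≤ B * ∑ i, |x i - y i| := fun k x y => by
    simpa using hμLip k s s x y
  have hηL : ∀ k (x y : Fin n → ℝ), |η k s x - η k s y| ≤ B * ∑ i, |x i - y i| := fun k x y => by
    simpa using hηLip k s s x y
  let h : Fin n → (Fin n → ℝ) → ℝ := fun j x => θh j * η j s x + (1 - θh j) * μ j s x
  have hhdep : ∀ (i : Fin n) (x y : Fin n → ℝ), (∀ j, j < i → x j = y j) → h i x = h i y :=
    fun i x y hxy => by simp only [h, hμdep i s x y hxy, hηdep i s x y hxy]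
  have hhD : ∀ j, Differentiable ℝ (h j) := fun j =>
    ((hD (hηC1 j)).const_mul _).add ((hD (hμC1 j)).const_mul _)
  have hpd : ∀ j x i, pd (h j) x i
      = θh j * pd (fun zv => η j s zv) x i + (1 - θh j) * pd (fun zv => μ j s zv) x i := by
    intro j x i
    rw [pd_eq_fderiv (hD (hηC1 j) x), pd_eq_fderiv (hD (hμC1 j) x), pd_eq_fderiv (hhD j x),
      (show HasFDerivAt (h j) _ x from ((hD (hηC1 j) x).hasFDerivAt.const_mul (θh j)).add
        ((hD (hμC1 j) x).hasFDerivAt.const_mul (1 - θh j))).fderiv]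
    rfl
  have hrec : ∀ (θ : Fin n → ℝ) (k : ℕ) (w : Fin n → ℝ) (j : Fin n), _ :=
    fwdFrom_eq μ η s (fun i => hμdep i s) (fun i => hηdep i s)
  have hzrec : ∀ j, z j = (1 - θ j) * μ j s z + θ j * η j s z := fun j => by
    rw [hz]
    exact (hrec θ 0 0 j).trans (if_neg (Nat.not_lt_zero _))
  have hzhrec : ∀ j, zh j = h j zh := fun j => by
    rw [hzh]
    exact ((hrec θh 0 0 j).trans (if_neg (Nat.not_lt_zero _))).trans (add_comm _ _)
  let w : Fin n → ℝ → Fin n → ℝ := fun i t =>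
    fwdFrom μ η s θh ((i : ℕ) + 1) (Function.update zh i t)
  have hwle : ∀ i t j, j ≤ i → w i t j = Function.update zh i t j := fun i t j hj =>
    (hrec θh _ _ j).trans (if_pos (Nat.lt_succ_of_le hj))
  have hwgt : ∀ i j t, i < j → w i t j = h j (w i t) := fun i j t hj =>
    ((hrec θh _ _ j).trans (if_neg (not_lt.2 hj))).trans (add_comm _ _)
  have hwz : ∀ i, w i (zh i) = zh := by
    intro i
    funext j
    induction j using WellFoundedLT.induction with
    | ind j ih =>
      rcases le_or_gt j i with hj | hj
      · rw [hwle i _ j hj, Function.update_eq_self]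
      · rw [hwgt i j _ hj, hzhrec j]
        exact hhdep j _ _ ih
  have hy : ∀ i, psiD f μ η s θh i = pd (fun zv => f s zv) zh i
      + ∑ j ∈ Finset.Ioi i, psiD f μ η s θh j * pd (h j) zh i := by
    have hψ : ∀ i, psiD f μ η s θh i = deriv (fun t => f s (w i t)) (zh i) := fun i => by
      simp only [w, hzh, psiD]
    intro i
    simp only [hψ]
    refine deriv_comp_eq_adjoint (hD hfC1) hhD hhdep hwz (fun i j t hj => ?_) (fun i t => ?_) hwgt i
    · rw [hwle i t j hj.le, Function.update_of_ne hj.ne]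
    · rw [hwle i t i le_rfl, Function.update_self]
  have hE : (1 + B) * ∑ i, |z i - zh i|
      ≤ (1 + B) ^ n * ∑ i, |θ i - θh i| * |η i s z - μ i s z| := by
    refine sum_le_of_le_add_sum_Iio hB.le (fun i => by positivity) fun i => ?_
    let x : Fin n → ℝ := fun j => if j < i then zh j else z j
    have hx : ∑ j, |z j - x j| = ∑ j ∈ Finset.Iio i, |z j - zh j| := by
      rw [← Finset.sum_subset (Finset.subset_univ (Finset.Iio i))]
      · refine Finset.sum_congr rfl fun j hj => ?_
        simp only [x, if_pos (Finset.mem_Iio.1 hj)]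
      · intro j _ hj
        simp only [x, if_neg fun hji => hj (Finset.mem_Iio.2 hji), sub_self, abs_zero]
    have hxh : h i zh = h i x := hhdep i _ _ fun j hj => by simp only [x, if_pos hj]
    have hsplit : z i - zh i = (θ i - θh i) * (η i s z - μ i s z)
        + (θh i * (η i s z - η i s x) + (1 - θh i) * (μ i s z - μ i s x)) := by
      rw [hzhrec i, hxh, hzrec i]
      ring
    rw [hsplit, ← abs_mul]
    refine (abs_add_le _ _).trans (add_le_add le_rfl ?_)
    rw [← hx]
    exact abs_convexComb_le (hθh i) (hηL i _ _) (hμL i _ _)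
  have hε : 0 ≤ β * ∑ i, |z i - zh i| := by positivity
  have hA : ∀ x j i, |pd (h j) x i| ≤ B := fun x j i => by
    rw [hpd]
    exact abs_convexComb_le (hθh j) (abs_pd_le hB.le (hηL j) x i) (abs_pd_le hB.le (hμL j) x i)
  have hR := sum_abs_sub_adjoint_le (A := fun j i => pd (h j) z i)
    (A' := fun j i => pd (h j) zh i) hB hε
    (fun i => by simpa only [hpd] using hg i) hy
    (fun i => abs_pd_le hB.le (fun x y => by simpa using hfLip s s x y) zh i)
    (hA z) (hA zh) (fun i => by simpa using (hfsmooth s s z zh).2 i) fun j i => by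
      simp only [hpd]
      rw [add_sub_add_comm, ← mul_sub, ← mul_sub]
      exact abs_convexComb_le (hθh j) (by simpa using (hηsmooth j s s z zh).2 i)
        (by simpa using (hμsmooth j s s z zh).2 i)
  have hD0 : 0 ≤ ∑ i, |θ i - θh i| * |η i s z - μ i s z| := by positivity
  generalize ∑ i, |θ i - θh i| * |η i s z - μ i s z| = D at hE hD0 ⊢
  generalize ∑ i, |z i - zh i| = E at hE hR
  generalize ∑ i, |g i - psiD f μ η s θh i| = R at hR ⊢
  have hBR : B * (1 + B) * R ≤ β * (1 + B) ^ (3 * n) * D :=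
    calc B * (1 + B) * R = (1 + B) * (B * R) := by ring
      _ ≤ (1 + B) * (β * E * (1 + B) ^ (2 * n)) := by gcongr
      _ = β * (1 + B) ^ (2 * n) * ((1 + B) * E) := by ring
      _ ≤ β * (1 + B) ^ (2 * n) * ((1 + B) ^ n * D) := by gcongr
      _ = β * (1 + B) ^ (3 * n) * D := by ring
  calc R ≤ β * (1 + B) ^ (3 * n) * D / (B * (1 + B)) := by
        rw [le_div_iff₀ (by positivity)]
        linarith
    _ ≤ β * (1 + B) ^ (3 * n) * D / (B ^ 2 / 2) := by
        gcongr
        nlinarith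
    _ = 2 * β / B ^ 2 * (1 + B) ^ (3 * n) * D := by
        field_simp

end
end
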